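/- Let (W,S) be a finite Coxeter system. For every integer k ≥ 1, the number of k-chains u₁ ≤ u₂ ≤ … ≤ u_k in the shard order ≤_σ on W equals the number of k-chains in the BHZ order ≤_β on W. -/

import Mathlib

open scoped Classical

namespace ShardBHZ

variable {B : Type*} {W : Type*} [Group W] {M : CoxeterMatrix B} (cs : CoxeterSystem M W)

/-- The support `S(w)` of `w`: the set of simple reflections appearing in some
(equivalently, any) reduced word for `w`. -/
def supp (w : W) : Set B := {i | ∃ l : List B, cs.IsReduced l ∧ cs.wordProd l = w ∧ i ∈ l}

/-- The standard parabolic subgroup `W_I` generated by the simple reflections in `I`. -/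
def parab (I : Set B) : Subgroup W := Subgroup.closure (cs.simple '' I)

/-- `x` has no right descent in `I`; this characterizes the minimal length coset
representatives `W^I` of `W / W_I`. -/
def IsMinRep (I : Set B) (x : W) : Prop := ∀ i ∈ I, ¬ cs.IsRightDescent x i

/-- The BHZ order: `u ≤_β v` iff the parabolic component `v_{S(u)}` equals `u`, i.e.
`v = (v * u⁻¹) * u` is the parabolic factorization of `v` with respect to `W_{S(u)}`:
`u ∈ W_{S(u)}`, `v * u⁻¹` has no right descent in `S(u)`, and lengths add. -/
def bhzLE (u v : W) : Prop :=
  u ∈ parab cs (supp cs u) ∧ IsMinRep cs (supp cs u) (v * u⁻¹) ∧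
    cs.length v = cs.length (v * u⁻¹) + cs.length u

/-- The set `N(w)` of left inversions of `w`. -/
def invSet (w : W) : Set W := {t | cs.IsLeftInversion w t}

/-- The subgroup `G(w)` generated by `w * s * w⁻¹` for `s` a right descent of `w`. -/
def descConj (w : W) : Subgroup W :=
  Subgroup.closure {x | ∃ i, cs.IsRightDescent w i ∧ x = w * cs.simple i * w⁻¹}

/-- The shard intersection order: `u ≤_σ v` iff `N(u) ⊆ N(v)` and `G(u) ⊆ G(v)`. -/
def shardLE (u v : W) : Prop := invSet cs u ⊆ invSet cs v ∧ descConj cs u ≤ descConj cs v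

section StrongExchange

theorem end_mul_apply {α : Type*} (f g : Function.End α) (x : α) : (f * g) x = f (g x) := rfl

theorem end_one_apply {α : Type*} (x : α) : (1 : Function.End α) x = x := rfl

/-- The action of a simple reflection on `W × ZMod 2` used to count, modulo two, the occurrences of
an element in inversion sequences. -/
noncomputable def signedConj (i : B) : Function.End (W × ZMod 2) := fun p =>
  (cs.simple i * p.1 * cs.simple i, p.2 + if p.1 = cs.simple i then 1 else 0)

theorem signedConj_mul_pow_apply (i j : B) (n : ℕ) (t : W) (ε : ZMod 2) :
    ((signedConj cs i * signedConj cs j) ^ n) (t, ε) =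
      ((cs.simple i * cs.simple j) ^ n * t * ((cs.simple i * cs.simple j) ^ n)⁻¹,
        ε + ∑ k ∈ Finset.range (2 * n),
          if t = ((cs.simple i * cs.simple j)⁻¹) ^ k * cs.simple j then 1 else 0) := by
  set c := cs.simple i * cs.simple j with hc
  have hcinv : c⁻¹ = cs.simple j * cs.simple i := by simp [hc]
  have hsemi (n : ℕ) : cs.simple j * c ^ n = c⁻¹ ^ n * cs.simple j := by
    have h : SemiconjBy (cs.simple j) c c⁻¹ := by
      simp [SemiconjBy, hc, mul_assoc]
    exact h.pow_right n
  induction n with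
  | zero => simp [end_one_apply]
  | succ n ih =>
    have h1 : c ^ n * t * (c ^ n)⁻¹ = cs.simple j ↔ t = c⁻¹ ^ (2 * n) * cs.simple j := by
      rw [two_mul, pow_add, mul_assoc (c⁻¹ ^ n), ← hsemi, inv_pow, mul_inv_eq_iff_eq_mul,
        eq_inv_mul_iff_mul_eq]
    have h2 : cs.simple j * (c ^ n * t * (c ^ n)⁻¹) * cs.simple j = cs.simple i ↔
        t = c⁻¹ ^ (2 * n + 1) * cs.simple j := by
      have h3 : cs.simple j * (c ^ n * t * (c ^ n)⁻¹) * cs.simple j = cs.simple i ↔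
          c ^ n * t * (c ^ n)⁻¹ = c⁻¹ * cs.simple j := by
        rw [hcinv]
        constructor
        · intro h; rw [← h]; simp [mul_assoc]
        · intro h; rw [h]; simp [mul_assoc]
      rw [h3, show 2 * n + 1 = n + 1 + n by ring, pow_add, mul_assoc (c⁻¹ ^ (n + 1)), ← hsemi,
        mul_inv_eq_iff_eq_mul, pow_succ, inv_pow, mul_assoc, mul_assoc]
      exact eq_inv_mul_iff_mul_eq.symm
    rw [pow_succ', end_mul_apply, ih, end_mul_apply]
    simp only [signedConj, h1, h2]
    refine Prod.ext ?_ ?_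
    · simp [pow_succ', hc, mul_assoc]
    · rw [show 2 * (n + 1) = 2 * n + 1 + 1 by ring, Finset.sum_range_succ, Finset.sum_range_succ]
      simp only [add_assoc]

theorem isLiftable_signedConj : M.IsLiftable (signedConj cs) := by
  intro i j
  funext ⟨t, ε⟩
  rw [signedConj_mul_pow_apply, two_mul, Finset.sum_range_add]
  have : ∀ k, ((cs.simple i * cs.simple j)⁻¹) ^ (M i j + k) =
      ((cs.simple i * cs.simple j)⁻¹) ^ k := by
    intro k; rw [pow_add, inv_pow, cs.simple_mul_simple_pow]; simp
  simp only [this, cs.simple_mul_simple_pow, CharTwo.add_self_eq_zero]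
  simp [end_one_apply]

/-- The number of occurrences, modulo two, of `t` in the left inversion sequence of any word
for `w`. -/
noncomputable def invParity (w t : W) : ZMod 2 :=
  (cs.lift ⟨signedConj cs, isLiftable_signedConj cs⟩ w⁻¹ (t, 0)).2

theorem lift_signedConj_wordProd_inv (l : List B) (t : W) (ε : ZMod 2) :
    cs.lift ⟨signedConj cs, isLiftable_signedConj cs⟩ (cs.wordProd l)⁻¹ (t, ε) =
      ((cs.wordProd l)⁻¹ * t * cs.wordProd l, ε + ((cs.leftInvSeq l).count t : ZMod 2)) := by
  induction l generalizing t ε with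
  | nil => simp [end_one_apply]
  | cons i l ih =>
    rw [cs.wordProd_cons, mul_inv_rev, map_mul, end_mul_apply,
      cs.inv_simple, cs.lift_apply_simple]
    simp only [signedConj]
    rw [ih]
    have h : (List.map (MulAut.conj (cs.simple i)) (cs.leftInvSeq l)).count t =
        (cs.leftInvSeq l).count (cs.simple i * t * cs.simple i) := by
      rw [← List.count_map_of_injective (cs.leftInvSeq l) (MulAut.conj (cs.simple i))
        (MulAut.conj (cs.simple i)).injective]
      simp [mul_assoc]
    rw [CoxeterSystem.leftInvSeq, List.count_cons, h]
    refine Prod.ext (by simp [mul_assoc]) ?_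
    by_cases ht : t = cs.simple i
    · simp [ht]; ring
    · simp [ht, Ne.symm ht]

theorem invParity_wordProd (l : List B) (t : W) :
    invParity cs (cs.wordProd l) t = ((cs.leftInvSeq l).count t : ZMod 2) := by
  simp [invParity, lift_signedConj_wordProd_inv]

theorem lift_signedConj_inv (w t : W) (ε : ZMod 2) :
    cs.lift ⟨signedConj cs, isLiftable_signedConj cs⟩ w⁻¹ (t, ε) =
      (w⁻¹ * t * w, ε + invParity cs w t) := by
  obtain ⟨l, rfl⟩ := cs.wordProd_surjective w
  rw [lift_signedConj_wordProd_inv, invParity_wordProd]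

theorem invParity_mul (u v t : W) :
    invParity cs (u * v) t = invParity cs u t + invParity cs v (u⁻¹ * t * u) := by
  have h := lift_signedConj_inv cs (u * v) t 0
  rw [mul_inv_rev, map_mul, end_mul_apply, lift_signedConj_inv,
    lift_signedConj_inv] at h
  simpa using (congrArg Prod.snd h).symm

theorem invParity_simple (i : B) : invParity cs (cs.simple i) (cs.simple i) = 1 := by
  simpa [CoxeterSystem.leftInvSeq] using invParity_wordProd cs [i] (cs.simple i)

theorem invParity_one (t : W) : invParity cs 1 t = 0 := by
  simpa [CoxeterSystem.leftInvSeq] using invParity_wordProd cs [] t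

theorem invParity_self {t : W} (ht : cs.IsReflection t) : invParity cs t t = 1 := by
  obtain ⟨w, i, rfl⟩ := ht
  have h0 : invParity cs w (w * cs.simple i * w⁻¹) +
      invParity cs w⁻¹ (cs.simple i) = 0 := by
    have := invParity_mul cs w w⁻¹ (w * cs.simple i * w⁻¹)
    rw [mul_inv_cancel, invParity_one] at this
    rw [this]; congr 2; group
  rw [invParity_mul, invParity_mul]
  have e1 : w⁻¹ * (w * cs.simple i * w⁻¹) * w = cs.simple i := by group
  have e2 : (w * cs.simple i)⁻¹ * (w * cs.simple i * w⁻¹) * (w * cs.simple i) = cs.simple i := by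
    simp [mul_assoc]
  rw [e1, e2, invParity_simple, add_right_comm, h0, zero_add]

theorem isLeftInversion_of_invParity_ne_zero {w t : W} (h : invParity cs w t ≠ 0) :
    cs.IsLeftInversion w t := by
  obtain ⟨l, hl, rfl⟩ := cs.exists_isReduced w
  apply cs.isLeftInversion_of_mem_leftInvSeq hl
  rw [invParity_wordProd] at h
  by_contra hn
  exact h (by simp [List.count_eq_zero_of_not_mem hn])

theorem isLeftInversion_iff_invParity {w t : W} (ht : cs.IsReflection t) :
    cs.IsLeftInversion w t ↔ invParity cs w t ≠ 0 := by
  refine ⟨fun h h0 => ?_, isLeftInversion_of_invParity_ne_zero cs⟩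
  have h1 : invParity cs (t * w) t ≠ 0 := by
    rw [invParity_mul, invParity_self cs ht]
    simp [h0]
  exact ht.isLeftInversion_mul_right_iff.mp (isLeftInversion_of_invParity_ne_zero cs h1) h

/-- The strong exchange property. -/
theorem mem_leftInvSeq_of_isLeftInversion {l : List B} {t : W}
    (h : cs.IsLeftInversion (cs.wordProd l) t) : t ∈ cs.leftInvSeq l := by
  have := (isLeftInversion_iff_invParity cs h.1).mp h
  rw [invParity_wordProd] at this
  by_contra hn
  exact this (by simp [List.count_eq_zero_of_not_mem hn])

end StrongExchange

/-- The cocycle property of left inversion sets. -/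
theorem isLeftInversion_mul_iff {t : W} (ht : cs.IsReflection t) (u v : W) :
    cs.IsLeftInversion (u * v) t ↔
      ¬ (cs.IsLeftInversion u t ↔ cs.IsLeftInversion v (u⁻¹ * t * u)) := by
  have ht' : cs.IsReflection (u⁻¹ * t * u) := by simpa using ht.conj u⁻¹
  rw [isLeftInversion_iff_invParity cs ht, isLeftInversion_iff_invParity cs ht,
    isLeftInversion_iff_invParity cs ht', invParity_mul]
  generalize invParity cs u t = a
  generalize invParity cs v _ = b
  revert a b
  decide

section InvSet

theorem mem_invSet_mul_conj {r : W} (hr : cs.IsReflection r) (u v : W) :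
    u * r * u⁻¹ ∈ invSet cs (u * v) ↔
      ¬ (u * r * u⁻¹ ∈ invSet cs u ↔ r ∈ invSet cs v) := by
  have h := isLeftInversion_mul_iff cs (hr.conj u) u v
  rwa [show u⁻¹ * (u * r * u⁻¹) * u = r by group] at h

theorem mem_invSet_mul {t : W} (ht : cs.IsReflection t) (u v : W) :
    t ∈ invSet cs (u * v) ↔ ¬ (t ∈ invSet cs u ↔ u⁻¹ * t * u ∈ invSet cs v) :=
  isLeftInversion_mul_iff cs ht u v

theorem notMem_invSet_one (t : W) : t ∉ invSet cs 1 := fun h => by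
  have := h.2
  simp at this

theorem mem_invSet_inv {t : W} (ht : cs.IsReflection t) (w : W) :
    t ∈ invSet cs w⁻¹ ↔ w * t * w⁻¹ ∈ invSet cs w := by
  have h := mem_invSet_mul_conj cs ht w w⁻¹
  rw [mul_inv_cancel] at h
  have := notMem_invSet_one cs (w * t * w⁻¹)
  tauto

theorem conj_simple_mem_invSet_iff (w : W) (i : B) :
    w * cs.simple i * w⁻¹ ∈ invSet cs w ↔ cs.IsRightDescent w i := by
  rw [← mem_invSet_inv cs (cs.isReflection_simple i), ← cs.isLeftDescent_inv_iff]
  exact cs.isLeftInversion_simple_iff_isLeftDescent _ _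

theorem self_mem_invSet {t : W} (ht : cs.IsReflection t) : t ∈ invSet cs t := by
  refine ⟨ht, ?_⟩
  rw [ht.mul_self, cs.length_one]
  exact ht.odd_length.pos

theorem ncard_invSet (w : W) : (invSet cs w).ncard = cs.length w := by
  obtain ⟨l, hl, rfl⟩ := cs.exists_isReduced w
  have : invSet cs (cs.wordProd l) = ((cs.leftInvSeq l).toFinset : Set W) := by
    ext t
    simp only [List.coe_toFinset, Set.mem_ofPred_eq]
    exact ⟨mem_leftInvSeq_of_isLeftInversion cs, cs.isLeftInversion_of_mem_leftInvSeq hl⟩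
  rw [this, Set.ncard_coe_finset, List.toFinset_card_of_nodup hl.nodup_leftInvSeq,
    cs.length_leftInvSeq, hl.eq]

variable [Finite W]

theorem length_mul_of_disjoint {u v : W}
    (h : ∀ r ∈ invSet cs v, u * r * u⁻¹ ∉ invSet cs u) :
    cs.length (u * v) = cs.length u + cs.length v := by
  have : invSet cs (u * v) = invSet cs u ∪ (MulAut.conj u) '' invSet cs v := by
    ext t
    have key (ht : cs.IsReflection t) :
        t ∈ invSet cs (u * v) ↔ (t ∈ invSet cs u ∨ u⁻¹ * t * u ∈ invSet cs v) := by
      rw [mem_invSet_mul cs ht]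
      have := h (u⁻¹ * t * u)
      rw [show u * (u⁻¹ * t * u) * u⁻¹ = t by group] at this
      tauto
    constructor
    · intro hm
      refine ((key hm.1).mp hm).imp id fun h' => ⟨_, h', ?_⟩
      rw [MulAut.conj_apply]; group
    · rintro (hm | ⟨r, hr, rfl⟩)
      · exact (key hm.1).mpr (Or.inl hm)
      · rw [MulAut.conj_apply] at *
        refine (key (hr.1.conj u)).mpr (Or.inr ?_)
        rwa [show u⁻¹ * (u * r * u⁻¹) * u = r by group]
  rw [← ncard_invSet, this, Set.ncard_union_eq, Set.ncard_image_of_injective _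
    (MulAut.conj u).injective, ncard_invSet, ncard_invSet]
  rw [Set.disjoint_right]
  rintro _ ⟨r, hr, rfl⟩
  exact h r hr

theorem length_eq_of_invSet_subset {u v : W} (h : invSet cs u ⊆ invSet cs v) :
    cs.length v = cs.length u + cs.length (u⁻¹ * v) := by
  rw [← length_mul_of_disjoint, mul_inv_cancel_left]
  intro r hr hu
  have := (mem_invSet_mul_conj cs hr.1 u (u⁻¹ * v)).mp
    (by rw [mul_inv_cancel_left]; exact h hu)
  tauto

theorem invSet_injective {u v : W} (h : invSet cs u = invSet cs v) : u = v := by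
  have h1 := length_eq_of_invSet_subset cs h.subset
  rw [← ncard_invSet cs u, ← ncard_invSet cs v, h] at h1
  have h2 : cs.length (u⁻¹ * v) = 0 := by omega
  exact inv_mul_eq_one.mp (cs.length_eq_zero_iff.mp h2)

end InvSet

section Parabolic

theorem mem_parab_iff {I : Set B} {w : W} :
    w ∈ parab cs I ↔ ∃ l : List B, (∀ i ∈ l, i ∈ I) ∧ cs.wordProd l = w := by
  constructor
  · intro h
    induction h using Subgroup.closure_induction with
    | mem x hx =>
      obtain ⟨i, hi, rfl⟩ := hx
      exact ⟨[i], by simpa using hi, by simp⟩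
    | one => exact ⟨[], by simp, by simp⟩
    | mul x y _ _ hx hy =>
      obtain ⟨l, hl, rfl⟩ := hx
      obtain ⟨l', hl', rfl⟩ := hy
      refine ⟨l ++ l', fun i hi => ?_, cs.wordProd_append _ _⟩
      exact (List.mem_append.mp hi).elim (hl i) (hl' i)
    | inv x _ hx =>
      obtain ⟨l, hl, rfl⟩ := hx
      exact ⟨l.reverse, by simpa using hl, by simp⟩
  · rintro ⟨l, hl, rfl⟩
    refine Subgroup.list_prod_mem _ fun x hx => ?_
    obtain ⟨i, hi, rfl⟩ := List.mem_map.mp hx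
    exact Subgroup.subset_closure ⟨i, hl i hi, rfl⟩

theorem simple_mem_parab {I : Set B} {i : B} (hi : i ∈ I) : cs.simple i ∈ parab cs I :=
  Subgroup.subset_closure ⟨i, hi, rfl⟩

theorem parab_mono {I J : Set B} (h : I ⊆ J) : parab cs I ≤ parab cs J :=
  Subgroup.closure_mono (Set.image_mono h)

theorem parab_le_iff {I : Set B} {H : Subgroup W} :
    parab cs I ≤ H ↔ ∀ i ∈ I, cs.simple i ∈ H := by
  rw [parab, Subgroup.closure_le]
  exact Set.image_subset_iff

theorem mem_parab_of_mem_leftInvSeq {I : Set B} {l : List B} (hl : ∀ i ∈ l, i ∈ I) {t : W}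
    (ht : t ∈ cs.leftInvSeq l) : t ∈ parab cs I := by
  induction l generalizing t with
  | nil => simp [CoxeterSystem.leftInvSeq] at ht
  | cons i l ih =>
    have hi := simple_mem_parab cs (hl i (by simp))
    rw [CoxeterSystem.leftInvSeq, List.mem_cons, List.mem_map] at ht
    obtain rfl | ⟨r, hr, rfl⟩ := ht
    · exact hi
    · exact mul_mem (mul_mem hi (ih (fun j hj => hl j (by simp [hj])) hr)) (inv_mem hi)

theorem mem_parab_of_mem_invSet {I : Set B} {w t : W} (hw : w ∈ parab cs I)
    (ht : t ∈ invSet cs w) : t ∈ parab cs I := by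
  obtain ⟨l, hl, rfl⟩ := (mem_parab_iff cs).mp hw
  exact mem_parab_of_mem_leftInvSeq cs hl (mem_leftInvSeq_of_isLeftInversion cs ht)

theorem simple_mem_parab_of_mem_supp {I : Set B} {w : W} (hw : w ∈ parab cs I) {i : B}
    (hi : i ∈ supp cs w) : cs.simple i ∈ parab cs I := by
  obtain ⟨l, hl, rfl, hil⟩ := hi
  induction l with
  | nil => simp at hil
  | cons j l ih =>
    have hj : cs.simple j ∈ parab cs I := by
      refine mem_parab_of_mem_invSet cs hw
        (cs.isLeftInversion_of_mem_leftInvSeq hl (by simp [CoxeterSystem.leftInvSeq]))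
    rcases List.mem_cons.mp hil with rfl | h
    · exact hj
    · rw [cs.wordProd_cons] at hw
      exact ih (by simpa using hl.drop 1) h ((mul_mem_cancel_left hj).mp hw)

theorem mem_parab_supp (w : W) : w ∈ parab cs (supp cs w) := by
  obtain ⟨l, hl, rfl⟩ := cs.exists_isReduced w
  exact (mem_parab_iff cs).mpr ⟨l, fun i hi => ⟨l, hl, rfl, hi⟩, rfl⟩

theorem exists_isReduced_of_mem_parab {I : Set B} {w : W} (hw : w ∈ parab cs I) :
    ∃ l : List B, (∀ i ∈ l, i ∈ I) ∧ cs.IsReduced l ∧ cs.wordProd l = w := by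
  obtain ⟨l, hl, rfl⟩ := (mem_parab_iff cs).mp hw
  clear hw
  induction l with
  | nil => exact ⟨[], by simp, by simp [CoxeterSystem.IsReduced], rfl⟩
  | cons i l ih =>
    obtain ⟨l', hl', hr, he⟩ := ih fun j hj => hl j (by simp [hj])
    by_cases hd : cs.IsLeftDescent (cs.wordProd l') i
    · obtain ⟨j, hj, hji⟩ := List.mem_iff_getElem.mp (mem_leftInvSeq_of_isLeftInversion cs
        ((cs.isLeftInversion_simple_iff_isLeftDescent _ _).mpr hd))
      have h1 := cs.getD_leftInvSeq_mul_wordProd l' j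
      rw [List.getD_eq_getElem _ _ hj, hji] at h1
      rw [cs.length_leftInvSeq] at hj
      refine ⟨l'.eraseIdx j, fun k hk => hl' k (List.mem_of_mem_eraseIdx hk), ?_, ?_⟩
      · have h2 := cs.isLeftDescent_iff.mp hd
        have h3 := List.length_eraseIdx_add_one hj
        rw [h1, hr.eq] at h2
        rw [CoxeterSystem.IsReduced]
        omega
      · rw [← h1, cs.wordProd_cons, he]
    · refine ⟨i :: l', ?_, ?_, ?_⟩
      · intro k hk
        rcases List.mem_cons.mp hk with rfl | hk
        · exact hl _ (by simp)
        · exact hl' k hk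
      · rw [CoxeterSystem.IsReduced, cs.wordProd_cons, cs.not_isLeftDescent_iff.mp hd, hr.eq]
        simp
      · rw [cs.wordProd_cons, cs.wordProd_cons, he]

theorem exists_leftDescent_of_mem_parab {I : Set B} {w : W} (hw : w ∈ parab cs I) (h1 : w ≠ 1) :
    ∃ i ∈ I, cs.IsLeftDescent w i := by
  obtain ⟨l, hl, hr, rfl⟩ := exists_isReduced_of_mem_parab cs hw
  cases l with
  | nil => simp at h1
  | cons i l =>
    exact ⟨i, hl i (by simp), (cs.isLeftInversion_simple_iff_isLeftDescent _ _).mp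
      (cs.isLeftInversion_of_mem_leftInvSeq hr (by simp [CoxeterSystem.leftInvSeq]))⟩

theorem exists_rightDescent_of_mem_parab {I : Set B} {w : W} (hw : w ∈ parab cs I) (h1 : w ≠ 1) :
    ∃ i ∈ I, cs.IsRightDescent w i := by
  simp only [← cs.isLeftDescent_inv_iff]
  exact exists_leftDescent_of_mem_parab cs (inv_mem hw) (by simpa using h1)

theorem exists_simple_eq_of_mem_parab {I : Set B} {i : B} (h : cs.simple i ∈ parab cs I) :
    ∃ j ∈ I, cs.simple i = cs.simple j := by
  have h1 : cs.simple i ≠ 1 := fun h => by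
    have := cs.length_simple i
    simp [h] at this
  obtain ⟨j, hj, hd⟩ := exists_leftDescent_of_mem_parab cs h h1
  refine ⟨j, hj, ?_⟩
  rw [CoxeterSystem.IsLeftDescent, cs.length_simple, Nat.lt_one_iff, cs.length_eq_zero_iff] at hd
  simpa using (eq_inv_of_mul_eq_one_right hd)

end Parabolic

section Cosets

/-- The element `x` has no inversion in `x W_I x⁻¹`. -/
def IsReducedRight (I : Set B) (x : W) : Prop :=
  ∀ r ∈ parab cs I, cs.IsReflection r → x * r * x⁻¹ ∉ invSet cs x

/-- The longest element of a standard parabolic subgroup, characterized by its inversion set. -/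
def IsLongest (I : Set B) (a : W) : Prop :=
  a ∈ parab cs I ∧ ∀ r ∈ parab cs I, cs.IsReflection r → r ∈ invSet cs a

variable {cs} in
theorem IsReducedRight.mem_invSet_mul_iff {I : Set B} {x : W} (hx : IsReducedRight cs I x)
    {r : W} (hr : r ∈ parab cs I) (ht : cs.IsReflection r) (u : W) :
    x * r * x⁻¹ ∈ invSet cs (x * u) ↔ r ∈ invSet cs u := by
  rw [mem_invSet_mul_conj cs ht]
  have := hx r hr ht
  tauto

variable {cs} in
theorem IsReducedRight.isRightDescent_mul_iff {I : Set B} {x : W} (hx : IsReducedRight cs I x)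
    {u : W} (hu : u ∈ parab cs I) {i : B} (hi : i ∈ I) :
    cs.IsRightDescent (x * u) i ↔ cs.IsRightDescent u i := by
  rw [← conj_simple_mem_invSet_iff, ← conj_simple_mem_invSet_iff, ← hx.mem_invSet_mul_iff
    (mul_mem (mul_mem hu (simple_mem_parab cs hi)) (inv_mem hu))
    ((cs.isReflection_simple i).conj u)]
  simp only [mul_assoc, mul_inv_rev]

variable {cs} in
theorem IsLongest.isRightDescent {I : Set B} {a : W} (ha : IsLongest cs I a) {i : B} (hi : i ∈ I) :
    cs.IsRightDescent a i := by
  rw [← conj_simple_mem_invSet_iff]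
  exact ha.2 _ (mul_mem (mul_mem ha.1 (simple_mem_parab cs hi)) (inv_mem ha.1))
    ((cs.isReflection_simple i).conj a)

variable [Finite W]

theorem exists_isReducedRight (I : Set B) (w : W) :
    ∃ x u, w = x * u ∧ u ∈ parab cs I ∧ IsReducedRight cs I x := by
  obtain ⟨x, hx, hmin⟩ := Set.exists_min_image {y : W | y⁻¹ * w ∈ parab cs I} cs.length
    (Set.toFinite _) ⟨w, by simp⟩
  refine ⟨x, x⁻¹ * w, by simp, hx, fun r hr _ hn => ?_⟩
  have h1 := hmin (x * r) (by
    rw [Set.mem_ofPred_eq, mul_inv_rev, mul_assoc]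
    exact mul_mem (inv_mem hr) hx)
  have h2 := hn.2
  rw [inv_mul_cancel_right] at h2
  omega

theorem isMinRep_iff {I : Set B} {x : W} : IsMinRep cs I x ↔ IsReducedRight cs I x := by
  constructor
  · intro h
    obtain ⟨y, u, rfl, hu, hy⟩ := exists_isReducedRight cs I x
    by_cases h1 : u = 1
    · simpa [h1] using hy
    · obtain ⟨i, hi, hd⟩ := exists_rightDescent_of_mem_parab cs hu h1
      exact absurd ((hy.isRightDescent_mul_iff hu hi).mpr hd) (h i hi)
  · intro h i hi hd
    exact h _ (simple_mem_parab cs hi) (cs.isReflection_simple i)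
      ((conj_simple_mem_invSet_iff cs x i).mpr hd)

variable {cs} in
theorem IsReducedRight.length_mul {I : Set B} {x u : W} (hx : IsReducedRight cs I x)
    (hu : u ∈ parab cs I) : cs.length (x * u) = cs.length x + cs.length u :=
  length_mul_of_disjoint cs fun r hr => hx r (mem_parab_of_mem_invSet cs hu hr) hr.1

theorem notMem_invSet_of_simple {I : Set B} {z : W} (h : ∀ i ∈ I, cs.simple i ∉ invSet cs z)
    {r : W} (hr : r ∈ parab cs I) : r ∉ invSet cs z := by
  intro hrz
  have h1 : IsMinRep cs I z⁻¹ := fun i hi hd => by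
    rw [cs.isRightDescent_inv_iff, ← cs.isLeftInversion_simple_iff_isLeftDescent] at hd
    exact h i hi hd
  refine (isMinRep_iff cs).mp h1 r hr hrz.1 ?_
  rw [← mem_invSet_inv cs hrz.1, inv_inv]
  exact hrz

theorem exists_mul_left_reduced (I : Set B) (w : W) :
    ∃ a z, w = a * z ∧ a ∈ parab cs I ∧ ∀ r ∈ parab cs I, r ∉ invSet cs z := by
  obtain ⟨x, u, h, hu, hx⟩ := exists_isReducedRight cs I w⁻¹
  refine ⟨u⁻¹, x⁻¹, by rw [← mul_inv_rev, ← h, inv_inv], inv_mem hu, fun r hr hn => ?_⟩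
  exact hx r hr hn.1 ((mem_invSet_inv cs hn.1 x).mp hn)

theorem exists_isLongest (I : Set B) : ∃ a, IsLongest cs I a := by
  obtain ⟨a, ha, hmax⟩ := Set.exists_max_image (parab cs I : Set W) cs.length
    (Set.toFinite _) ⟨1, one_mem _⟩
  refine ⟨a, ha, fun r hr ht => ⟨ht, ?_⟩⟩
  exact lt_of_le_of_ne (hmax _ (mul_mem hr ha)) (ht.length_mul_right_ne a)

variable {cs} in
theorem IsLongest.eq {I : Set B} {a b : W} (ha : IsLongest cs I a) (hb : IsLongest cs I b) :
    a = b := by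
  apply invSet_injective cs
  ext t
  exact ⟨fun h => hb.2 t (mem_parab_of_mem_invSet cs ha.1 h) h.1,
    fun h => ha.2 t (mem_parab_of_mem_invSet cs hb.1 h) h.1⟩

theorem isLongest_of_descents {I : Set B} {a : W} (ha : a ∈ parab cs I)
    (h : ∀ i ∈ I, cs.IsRightDescent a i) : IsLongest cs I a := by
  obtain ⟨a₀, h₀⟩ := exists_isLongest cs I
  obtain ⟨b, rfl⟩ : ∃ b, a = a₀ * b := ⟨a₀⁻¹ * a, by simp⟩
  have hb : b ∈ parab cs I := (mul_mem_cancel_left h₀.1).mp ha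
  by_cases h1 : b = 1
  · simpa [h1] using h₀
  · exfalso
    obtain ⟨i, hi, hd⟩ := exists_rightDescent_of_mem_parab cs hb h1
    have hr := (cs.isReflection_simple i).conj b
    have hp := mul_mem (mul_mem hb (simple_mem_parab cs hi)) (inv_mem hb)
    have h2 := (conj_simple_mem_invSet_iff cs _ i).mpr (h i hi)
    rw [show a₀ * b * cs.simple i * (a₀ * b)⁻¹ = a₀ * (b * cs.simple i * b⁻¹) * a₀⁻¹ by group,
      mem_invSet_mul_conj cs hr, conj_simple_mem_invSet_iff] at h2
    exact h2 ⟨fun _ => hd, fun _ => h₀.2 _ (mul_mem (mul_mem h₀.1 hp) (inv_mem h₀.1))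
      (hr.conj _)⟩

/-- An element with all of `I` as right descents is a reduced product of a minimal coset
representative and the longest element of `W_I`. -/
theorem exists_eq_mul_longest {I : Set B} {v : W} (h : ∀ i ∈ I, cs.IsRightDescent v i) :
    ∃ x a, v = x * a ∧ IsReducedRight cs I x ∧ IsLongest cs I a := by
  obtain ⟨x, a, rfl, ha, hx⟩ := exists_isReducedRight cs I v
  exact ⟨x, a, rfl, hx, isLongest_of_descents cs ha fun i hi =>
    (hx.isRightDescent_mul_iff ha hi).mp (h i hi)⟩

/-- If all of `I` are right descents of `v` then all reflections in `v W_I v⁻¹` are inversions. -/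
theorem conj_mem_invSet_of_descents {I : Set B} {v : W} (h : ∀ i ∈ I, cs.IsRightDescent v i)
    {r : W} (hr : r ∈ parab cs I) (ht : cs.IsReflection r) : v * r * v⁻¹ ∈ invSet cs v := by
  obtain ⟨x, a, rfl, hx, ha⟩ := exists_eq_mul_longest cs h
  have hp := mul_mem (mul_mem ha.1 hr) (inv_mem ha.1)
  rw [show x * a * r * (x * a)⁻¹ = x * (a * r * a⁻¹) * x⁻¹ by group,
    hx.mem_invSet_mul_iff hp (ht.conj a)]
  exact ha.2 _ hp (ht.conj a)

end Cosets

section Covers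

theorem mem_invSet_simple_iff {i : B} {r : W} :
    r ∈ invSet cs (cs.simple i) ↔ r = cs.simple i := by
  constructor
  · intro h
    have := mem_leftInvSeq_of_isLeftInversion cs (l := [i]) (t := r)
      (by rw [cs.wordProd_singleton]; exact h)
    simpa [CoxeterSystem.leftInvSeq] using this
  · rintro rfl
    exact self_mem_invSet cs (cs.isReflection_simple i)

theorem conj_inv_eq_iff {w t r : W} : w⁻¹ * t * w = r ↔ t = w * r * w⁻¹ := by
  constructor
  · rintro rfl; group
  · rintro rfl; group

/-- The cover reflections of `w`. -/
def coverRefl (w : W) : Set W :=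
  {t | ∃ i, cs.IsRightDescent w i ∧ t = w * cs.simple i * w⁻¹}

theorem coverRefl_subset_descConj (w : W) : coverRefl cs w ⊆ descConj cs w :=
  Subgroup.subset_closure

theorem descConj_le_iff {w : W} {H : Subgroup W} :
    descConj cs w ≤ H ↔ coverRefl cs w ⊆ H :=
  Subgroup.closure_le H

theorem mem_invSet_mul_simple_iff {w t : W} {i : B} (hi : cs.IsRightDescent w i) :
    t ∈ invSet cs (w * cs.simple i) ↔ t ∈ invSet cs w ∧ t ≠ w * cs.simple i * w⁻¹ := by
  by_cases ht : cs.IsReflection t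
  · rw [mem_invSet_mul cs ht, mem_invSet_simple_iff, conj_inv_eq_iff]
    have h1 := (conj_simple_mem_invSet_iff cs w i).mpr hi
    by_cases h2 : t = w * cs.simple i * w⁻¹
    · rw [← h2] at h1
      tauto
    · tauto
  · exact ⟨fun h => absurd h.1 ht, fun h => absurd h.1.1 ht⟩

theorem mem_invSet_longest_iff {I : Set B} {a r : W} (ha : IsLongest cs I a)
    (hr : cs.IsReflection r) : r ∈ invSet cs a ↔ r ∈ parab cs I :=
  ⟨mem_parab_of_mem_invSet cs ha.1, fun h => ha.2 r h hr⟩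

theorem mem_parab_conj_simple {I : Set B} {i : B} (hi : i ∈ I) (r : W) :
    (cs.simple i)⁻¹ * r * cs.simple i ∈ parab cs I ↔ r ∈ parab cs I := by
  have := simple_mem_parab cs hi
  rw [mul_mem_cancel_right this, mul_mem_cancel_left (inv_mem this)]

variable [Finite W]

theorem mem_invSet_mul_longest_iff {I : Set B} {w a : W} (hw : ∀ i ∈ I, cs.IsRightDescent w i)
    (ha : IsLongest cs I a) {t : W} :
    t ∈ invSet cs (w * a) ↔ t ∈ invSet cs w ∧ w⁻¹ * t * w ∉ parab cs I := by
  by_cases ht : cs.IsReflection t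
  · have hr : cs.IsReflection (w⁻¹ * t * w) := by simpa using ht.conj w⁻¹
    rw [mem_invSet_mul cs ht, mem_invSet_longest_iff cs ha hr]
    have h1 : w⁻¹ * t * w ∈ parab cs I → t ∈ invSet cs w := fun h => by
      have := conj_mem_invSet_of_descents cs hw h hr
      rwa [show w * (w⁻¹ * t * w) * w⁻¹ = t by group] at this
    tauto
  · exact ⟨fun h => absurd h.1 ht, fun h => absurd h.1.1 ht⟩

theorem mem_invSet_mul_simple_mul_longest_iff {I : Set B} {w a : W}
    (hw : ∀ i ∈ I, cs.IsRightDescent w i) (ha : IsLongest cs I a) {j : B} (hj : j ∈ I) {t : W} :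
    t ∈ invSet cs (w * (cs.simple j * a)) ↔
      t ∈ invSet cs w ∧ (w⁻¹ * t * w ∈ parab cs I → t = w * cs.simple j * w⁻¹) := by
  by_cases ht : cs.IsReflection t
  · have hr : cs.IsReflection (w⁻¹ * t * w) := by simpa using ht.conj w⁻¹
    rw [mem_invSet_mul cs ht, mem_invSet_mul cs hr, mem_invSet_simple_iff,
      mem_invSet_longest_iff cs ha (by simpa using hr.conj (cs.simple j)⁻¹),
      mem_parab_conj_simple cs hj, conj_inv_eq_iff]
    have h1 : w⁻¹ * t * w ∈ parab cs I → t ∈ invSet cs w := fun h => by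
      have := conj_mem_invSet_of_descents cs hw h hr
      rwa [show w * (w⁻¹ * t * w) * w⁻¹ = t by group] at this
    have h2 : t = w * cs.simple j * w⁻¹ → w⁻¹ * t * w ∈ parab cs I := fun h => by
      rw [conj_inv_eq_iff.mpr h]
      exact simple_mem_parab cs hj
    tauto
  · exact ⟨fun h => absurd h.1 ht, fun h => absurd h.1.1 ht⟩

theorem mem_coverRefl_iff {w t : W} :
    t ∈ coverRefl cs w ↔
      t ∈ invSet cs w ∧ ∀ r ∈ invSet cs w, r ≠ t → r ∈ invSet cs (t * w) := by
  constructor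
  · rintro ⟨i, hi, rfl⟩
    refine ⟨(conj_simple_mem_invSet_iff cs w i).mpr hi, fun r hr hne => ?_⟩
    rw [inv_mul_cancel_right]
    exact (mem_invSet_mul_simple_iff cs hi).mpr ⟨hr, hne⟩
  · rintro ⟨ht, h⟩
    have hsub : invSet cs w \ {t} ⊆ invSet cs (t * w) := fun r hr => h r hr.1 hr.2
    have hcard := Set.ncard_sdiff_singleton_add_one ht (Set.toFinite _)
    have hlt := ht.2
    rw [← ncard_invSet, ← ncard_invSet] at hlt
    have heq := Set.eq_of_subset_of_ncard_le hsub (by omega) (Set.toFinite _)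
    have hlen := length_eq_of_invSet_subset cs (heq.symm.subset.trans Set.sdiff_subset)
    rw [← ncard_invSet, ← ncard_invSet, ← heq] at hlen
    obtain ⟨i, hi⟩ := cs.length_eq_one_iff.mp (show cs.length ((t * w)⁻¹ * w) = 1 by omega)
    have hw : t = w * cs.simple i * w⁻¹ := by
      rw [← hi, mul_inv_rev, ht.1.inv]; group
    exact ⟨i, (conj_simple_mem_invSet_iff cs w i).mp (hw ▸ ht), hw⟩

theorem length_lt_of_invSet_ssubset {u v : W} (h : invSet cs u ⊂ invSet cs v) :
    cs.length u < cs.length v := by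
  rw [← ncard_invSet, ← ncard_invSet]
  exact Set.ncard_lt_ncard h (Set.toFinite _)

end Covers

section Retract

/-- The element `u` lies weakly below `w`, has the same inversions as `w` inside `G`, and all its
cover reflections are in `G`. -/
def IsRetract (G : Subgroup W) (w u : W) : Prop :=
  invSet cs u ⊆ invSet cs w ∧ (∀ t ∈ G, t ∈ invSet cs w → t ∈ invSet cs u) ∧
    coverRefl cs u ⊆ G

variable {cs} {G : Subgroup W} {x : W}

theorem IsRetract.lift {w w' u : W} (h : IsRetract cs G w' u) (hsub : invSet cs w' ⊆ invSet cs w)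
    (hG : ∀ t ∈ G, t ∈ invSet cs w → t ∈ invSet cs w') : IsRetract cs G w u :=
  ⟨h.1.trans hsub, fun t ht htw => h.2.1 t ht (hG t ht htw), h.2.2⟩

theorem IsRetract.lift_simple {w u : W} {i : B} (hi : cs.IsRightDescent w i)
    (hG : w * cs.simple i * w⁻¹ ∉ G) (h : IsRetract cs G (w * cs.simple i) u) :
    IsRetract cs G w u :=
  h.lift (fun _ ht => ((mem_invSet_mul_simple_iff cs hi).mp ht).1) fun t ht htw =>
    (mem_invSet_mul_simple_iff cs hi).mpr ⟨htw, by rintro rfl; exact hG ht⟩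

theorem exists_isRetract (G : Subgroup W) (w : W) : ∃ u, IsRetract cs G w u := by
  induction hn : cs.length w using Nat.strong_induction_on generalizing w with
  | _ n ih =>
    by_cases hc : coverRefl cs w ⊆ G
    · exact ⟨w, subset_rfl, fun _ _ h => h, hc⟩
    · obtain ⟨_, ⟨i, hi, rfl⟩, hG⟩ := Set.not_subset.mp hc
      obtain ⟨u, hu⟩ := ih _ (hn ▸ hi) (w * cs.simple i) rfl
      exact ⟨u, hu.lift_simple hi hG⟩

variable [Finite W]

theorem IsRetract.eq_or_exists {w u : W} (h : IsRetract cs G w u) :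
    u = w ∨ ∃ i, cs.IsRightDescent w i ∧ w * cs.simple i * w⁻¹ ∉ G ∧
      IsRetract cs G (w * cs.simple i) u := by
  by_cases h1 : u⁻¹ * w = 1
  · exact Or.inl (inv_mul_eq_one.mp h1)
  · right
    obtain ⟨z, rfl⟩ : ∃ z, w = u * z := ⟨u⁻¹ * w, by simp⟩
    have hlen := length_eq_of_invSet_subset cs h.1
    rw [inv_mul_cancel_left] at hlen h1
    obtain ⟨i, hi⟩ := cs.exists_rightDescent_of_ne_one h1
    have hd : cs.IsRightDescent (u * z) i := by
      have := cs.length_mul_le u (z * cs.simple i)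
      rw [CoxeterSystem.IsRightDescent] at hi ⊢
      rw [mul_assoc]
      omega
    have hm := (conj_simple_mem_invSet_iff cs _ _).mpr hd
    have hu : u * z * cs.simple i * (u * z)⁻¹ ∉ invSet cs u := by
      have h2 := (conj_simple_mem_invSet_iff cs _ _).mpr hi
      have h3 := mem_invSet_mul_conj cs h2.1 u z
      rw [show u * (z * cs.simple i * z⁻¹) * u⁻¹ = u * z * cs.simple i * (u * z)⁻¹ by group] at h3
      tauto
    refine ⟨i, hd, fun hG => hu (h.2.1 _ hG hm), fun t ht => ?_, fun t ht htw => ?_, h.2.2⟩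
    · exact (mem_invSet_mul_simple_iff cs hd).mpr ⟨h.1 ht, by rintro rfl; exact hu ht⟩
    · exact h.2.1 t ht ((mem_invSet_mul_simple_iff cs hd).mp htw).1

theorem IsRetract.eq_of_coverRefl_subset {w u : W} (h : IsRetract cs G w u)
    (hc : coverRefl cs w ⊆ G) : u = w := by
  rcases h.eq_or_exists with rfl | ⟨i, hi, hG, _⟩
  · rfl
  · exact absurd (hc ⟨i, hi, rfl⟩) hG

/-- Inside a parabolic subgroup generated by descents of `w`, being an inversion of `x` is the
opposite of being an inversion of `w⁻¹ * x`. -/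
theorem conj_mem_invSet_iff_notMem {I : Set B} {w : W} (hw : ∀ i ∈ I, cs.IsRightDescent w i) (x : W)
    {r : W} (hr : r ∈ parab cs I) (ht : cs.IsReflection r) :
    w * r * w⁻¹ ∈ invSet cs x ↔ r ∉ invSet cs (w⁻¹ * x) := by
  have h := mem_invSet_mul_conj cs ht w (w⁻¹ * x)
  rw [mul_inv_cancel_left] at h
  have := conj_mem_invSet_of_descents cs hw hr ht
  tauto

/-- If the cover reflections of `w` indexed by `I` are inversions of `x`, then so are all
reflections in `w W_I w⁻¹`. -/
theorem conj_mem_invSet_of_simple {I : Set B} {w : W} (hw : ∀ i ∈ I, cs.IsRightDescent w i)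
    (hx : ∀ i ∈ I, w * cs.simple i * w⁻¹ ∈ invSet cs x)
    {r : W} (hr : r ∈ parab cs I) (ht : cs.IsReflection r) : w * r * w⁻¹ ∈ invSet cs x := by
  rw [conj_mem_invSet_iff_notMem hw x hr ht]
  refine notMem_invSet_of_simple cs (fun i hi => ?_) hr
  rw [← conj_mem_invSet_iff_notMem hw x (simple_mem_parab cs hi) (cs.isReflection_simple i)]
  exact hx i hi

theorem IsRetract.unique (hx : ∀ t ∈ G, t ∉ invSet cs x) {w : W}
    (hw : invSet cs w ⊆ invSet cs x ∪ G) {u₁ u₂ : W} (h₁ : IsRetract cs G w u₁)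
    (h₂ : IsRetract cs G w u₂) : u₁ = u₂ := by
  induction hn : cs.length w using Nat.strong_induction_on generalizing w u₁ u₂ with
  | _ n ih =>
    rcases h₁.eq_or_exists with rfl | ⟨p, hp, hpG, hp'⟩
    · exact (h₂.eq_of_coverRefl_subset h₁.2.2).symm
    rcases h₂.eq_or_exists with rfl | ⟨q, hq, hqG, hq'⟩
    · exact h₁.eq_of_coverRefl_subset h₂.2.2
    have hd : ∀ i ∈ ({p, q} : Set B), cs.IsRightDescent w i := by
      rintro i (rfl | rfl) <;> assumption
    have hdG : ∀ i ∈ ({p, q} : Set B), w * cs.simple i * w⁻¹ ∉ G := by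
      rintro i (rfl | rfl) <;> assumption
    obtain ⟨a, ha⟩ := exists_isLongest cs ({p, q} : Set B)
    obtain ⟨u, hu⟩ := exists_isRetract (cs := cs) G (w * a)
    have key : ∀ i ∈ ({p, q} : Set B), ∀ v, IsRetract cs G (w * cs.simple i) v → v = u := by
      intro i hi v hv
      refine ih _ (hn ▸ hd i hi) (fun t ht =>
        hw ((mem_invSet_mul_simple_iff cs (hd i hi)).mp ht).1) hv (hu.lift ?_ ?_) rfl
      · intro t ht
        rw [mem_invSet_mul_longest_iff cs hd ha] at ht
        refine (mem_invSet_mul_simple_iff cs (hd i hi)).mpr ⟨ht.1, fun h => ht.2 ?_⟩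
        rw [conj_inv_eq_iff.mpr h]
        exact simple_mem_parab cs hi
      · intro t ht htw
        have htw' := ((mem_invSet_mul_simple_iff cs (hd i hi)).mp htw).1
        refine (mem_invSet_mul_longest_iff cs hd ha).mpr ⟨htw', fun hm => hx t ht ?_⟩
        have := conj_mem_invSet_of_simple (x := x) hd (fun j hj =>
          (hw ((conj_simple_mem_invSet_iff cs w j).mpr (hd j hj))).resolve_right (hdG j hj)) hm
          (by simpa using htw.1.conj w⁻¹)
        rwa [show w * (w⁻¹ * t * w) * w⁻¹ = t by group] at this
    rw [key p (by simp) u₁ hp', key q (by simp) u₂ hq']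

/-- In rank two: if exactly one of the two cover reflections lies in `G`, then it is the only
reflection of the rank two parabolic subgroup lying in `G`. -/
theorem eq_of_mem_rank_two (hx : ∀ t ∈ G, t ∉ invSet cs x) {w : W}
    (hw : invSet cs w ⊆ invSet cs x ∪ G) {p s : B}
    (hd : ∀ i ∈ ({p, s} : Set B), cs.IsRightDescent w i)
    (hp : w * cs.simple p * w⁻¹ ∉ G) (hs : w * cs.simple s * w⁻¹ ∈ G)
    {r : W} (hr : r ∈ parab cs {p, s}) (ht : cs.IsReflection r) (hrG : w * r * w⁻¹ ∈ G) :
    r = cs.simple s := by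
  have hps : cs.simple p ≠ cs.simple s := fun h => hp (h ▸ hs)
  have hG : ∀ r ∈ parab cs {p, s}, cs.IsReflection r →
      (r ∈ invSet cs (w⁻¹ * x) ↔ w * r * w⁻¹ ∈ G) := fun r hr ht => by
    have h1 := conj_mem_invSet_iff_notMem hd x hr ht
    have h2 := hx (w * r * w⁻¹)
    have h3 := hw (conj_mem_invSet_of_descents cs hd hr ht)
    rw [Set.mem_union] at h3
    have h4 : w * r * w⁻¹ ∈ (G : Set W) ↔ w * r * w⁻¹ ∈ G := Iff.rfl
    tauto
  have hsP : cs.simple s ∈ parab cs {p, s} := simple_mem_parab cs (by simp)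
  have hpP : cs.simple p ∈ parab cs {p, s} := simple_mem_parab cs (by simp)
  obtain ⟨c, z, hz, hc, hzr⟩ := exists_mul_left_reduced cs {p, s} (w⁻¹ * x)
  have hcG : ∀ r ∈ parab cs {p, s}, cs.IsReflection r →
      (r ∈ invSet cs c ↔ w * r * w⁻¹ ∈ G) := fun r hr ht => by
    rw [← hG r hr ht, hz, mem_invSet_mul cs ht]
    have := hzr (c⁻¹ * r * c) (mul_mem (mul_mem (inv_mem hc) hr) hc)
    tauto
  obtain ⟨c', rfl⟩ : ∃ c', c = cs.simple s * c' := ⟨cs.simple s * c, by simp⟩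
  have hc' : c' ∈ parab cs {p, s} := (mul_mem_cancel_left hsP).mp hc
  have h1 : c' = 1 := by
    by_contra hne
    obtain ⟨i, hi, hid⟩ := exists_leftDescent_of_mem_parab cs hc' hne
    rw [← cs.isLeftInversion_simple_iff_isLeftDescent] at hid
    rcases hi with rfl | rfl
    · refine hp ?_
      have hR := (cs.isReflection_simple i).conj (cs.simple s)
      have hP := mul_mem (mul_mem hsP hpP) (inv_mem hsP)
      have h2 : cs.simple s * cs.simple i * (cs.simple s)⁻¹ ∈ invSet cs (cs.simple s * c') := by
        rw [mem_invSet_mul_conj cs (cs.isReflection_simple i), mem_invSet_simple_iff]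
        intro h
        have h2 := h.mpr hid
        rw [mul_inv_eq_iff_eq_mul, mul_right_inj] at h2
        exact hps h2
      rw [hcG _ hP hR] at h2
      have h3 := mul_mem (mul_mem (inv_mem hs) h2) hs
      have h4 : (w * cs.simple s * w⁻¹)⁻¹ *
          (w * (cs.simple s * cs.simple i * (cs.simple s)⁻¹) * w⁻¹) * (w * cs.simple s * w⁻¹) =
          w * cs.simple i * w⁻¹ := by group
      rwa [h4] at h3
    · have h2 := (hcG _ hsP (cs.isReflection_simple _)).mpr hs
      rw [mem_invSet_mul cs (cs.isReflection_simple _), mem_invSet_simple_iff] at h2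
      simp only [inv_mul_cancel, one_mul, true_iff] at h2
      exact h2 hid
  have h2 := (hcG r hr ht).mpr hrG
  rwa [h1, mul_one, mem_invSet_simple_iff] at h2

theorem IsRetract.mem_coverRefl (hx : ∀ t ∈ G, t ∉ invSet cs x) {w : W}
    (hw : invSet cs w ⊆ invSet cs x ∪ G) {u : W} (h : IsRetract cs G w u) {t : W}
    (ht : t ∈ coverRefl cs w) (htG : t ∈ G) : t ∈ coverRefl cs u := by
  induction hn : cs.length w using Nat.strong_induction_on generalizing w with
  | _ n ih =>
    rcases h.eq_or_exists with rfl | ⟨p, hp, hpG, -⟩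
    · exact ht
    obtain ⟨s, hs, rfl⟩ := ht
    have hd : ∀ i ∈ ({p, s} : Set B), cs.IsRightDescent w i := by
      rintro i (rfl | rfl) <;> assumption
    have hpP : cs.simple p ∈ parab cs {p, s} := simple_mem_parab cs (by simp)
    obtain ⟨a, ha⟩ := exists_isLongest cs ({p, s} : Set B)
    have hmem (τ : W) := mem_invSet_mul_simple_mul_longest_iff cs hd ha (j := s) (by simp) (t := τ)
    set w' := w * (cs.simple s * a) with hw'
    have hsub : invSet cs w' ⊆ invSet cs w := fun τ hτ => ((hmem τ).mp hτ).1
    have hlt : cs.length w' < cs.length w := by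
      refine length_lt_of_invSet_ssubset cs ⟨hsub, fun hsup => ?_⟩
      have := ((hmem _).mp (hsup ((conj_simple_mem_invSet_iff cs w p).mpr hp))).2
        (by rw [conj_inv_eq_iff.mpr rfl]; exact hpP)
      exact hpG (this ▸ htG)
    have hGw' : ∀ τ ∈ G, τ ∈ invSet cs w → τ ∈ invSet cs w' := fun τ hτ hτw => by
      refine (hmem τ).mpr ⟨hτw, fun hP => ?_⟩
      rw [← conj_inv_eq_iff]
      refine eq_of_mem_rank_two hx hw hd hpG htG hP (by simpa using hτw.1.conj w⁻¹) ?_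
      rwa [show w * (w⁻¹ * τ * w) * w⁻¹ = τ by group]
    obtain ⟨u', hu'⟩ := exists_isRetract (cs := cs) G w'
    obtain rfl : u = u' := h.unique hx hw (hu'.lift hsub hGw')
    refine ih _ (hn ▸ hlt) (hsub.trans hw) hu' ?_ rfl
    rw [mem_coverRefl_iff]
    refine ⟨hGw' _ htG ((conj_simple_mem_invSet_iff cs w s).mpr hs), fun τ hτ hne => ?_⟩
    rw [show w * cs.simple s * w⁻¹ * w' = w * a by rw [hw']; simp [mul_assoc]]
    rw [hmem] at hτ
    exact (mem_invSet_mul_longest_iff cs hd ha).mpr ⟨hτ.1, fun hP => hne (hτ.2 hP)⟩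

end Retract

section Support

theorem supp_union_subset {x u : W} (h : cs.length (x * u) = cs.length x + cs.length u) :
    supp cs x ∪ supp cs u ⊆ supp cs (x * u) := by
  have key : ∀ l l', cs.IsReduced l → cs.IsReduced l' → cs.wordProd l = x → cs.wordProd l' = u →
      ∀ i ∈ l ++ l', i ∈ supp cs (x * u) := fun l l' hl hl' hx hu i hi => by
    subst hx hu
    exact ⟨l ++ l', by rw [CoxeterSystem.IsReduced, cs.wordProd_append, h, hl, hl',
      List.length_append], cs.wordProd_append _ _, hi⟩
  rintro i (⟨l, hl, hx, hi⟩ | ⟨l', hl', hu, hi⟩)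
  · obtain ⟨l', hl', hu⟩ := cs.exists_isReduced u
    exact key l l' hl hl' hx hu.symm i (by simp [hi])
  · obtain ⟨l, hl, hx⟩ := cs.exists_isReduced x
    exact key l l' hl hl' hx.symm hu i (by simp [hi])

end Support

section ShardInterval

/-- The right descent set of `w`. -/
def descSet (w : W) : Set B := {i | cs.IsRightDescent w i}

theorem descConj_eq_map {u a x : W} (h : ∀ r, x * r * x⁻¹ ∈ coverRefl cs u ↔ r ∈ coverRefl cs a) :
    descConj cs u = (descConj cs a).map (MulAut.conj x).toMonoidHom := by
  have hu : descConj cs u = Subgroup.closure (coverRefl cs u) := rfl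
  have ha : descConj cs a = Subgroup.closure (coverRefl cs a) := rfl
  rw [hu, ha, MonoidHom.map_closure]
  congr 1
  ext t
  constructor
  · intro ht
    refine ⟨x⁻¹ * t * x, (h _).mp ?_, ?_⟩
    · rwa [show x * (x⁻¹ * t * x) * x⁻¹ = t by group]
    · simp [mul_assoc]
  · rintro ⟨r, hr, rfl⟩
    exact (h r).mpr hr

theorem conj_mem_map_conj {H : Subgroup W} {x g : W} :
    x * g * x⁻¹ ∈ H.map (MulAut.conj x).toMonoidHom ↔ g ∈ H :=
  Subgroup.mem_map_iff_mem (f := (MulAut.conj x).toMonoidHom) (MulAut.conj x).injective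

theorem mem_descConj_iff {v x : W} (hv : x⁻¹ * v ∈ parab cs (descSet cs v)) (r : W) :
    x * r * x⁻¹ ∈ descConj cs v ↔ r ∈ parab cs (descSet cs v) := by
  have h : descConj cs v = (parab cs (descSet cs v)).map (MulAut.conj v).toMonoidHom := by
    rw [parab, MonoidHom.map_closure, descConj]
    congr 1
    ext t
    constructor
    · rintro ⟨i, hi, rfl⟩
      exact ⟨_, ⟨i, hi, rfl⟩, rfl⟩
    · rintro ⟨_, ⟨i, hi, rfl⟩, rfl⟩
      exact ⟨i, hi, rfl⟩
  rw [h, show x * r * x⁻¹ = v * ((x⁻¹ * v)⁻¹ * r * (x⁻¹ * v)) * v⁻¹ by group, conj_mem_map_conj,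
    mul_mem_cancel_right hv, mul_mem_cancel_left (inv_mem hv)]

theorem shardLE.trans {u v w : W} (h : shardLE cs u v) (h' : shardLE cs v w) : shardLE cs u w :=
  ⟨h.1.trans h'.1, h.2.trans h'.2⟩

variable {cs} in
theorem IsReducedRight.mem_invSet_mul_iff_or {I : Set B} {x a t : W} (hx : IsReducedRight cs I x)
    (ha : a ∈ parab cs I) (ht : cs.IsReflection t) :
    t ∈ invSet cs (x * a) ↔ t ∈ invSet cs x ∨ x⁻¹ * t * x ∈ invSet cs a := by
  rw [mem_invSet_mul cs ht]
  have : x⁻¹ * t * x ∈ invSet cs a → t ∉ invSet cs x := fun h => by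
    have := hx _ (mem_parab_of_mem_invSet cs ha h) h.1
    rwa [show x * (x⁻¹ * t * x) * x⁻¹ = t by group] at this
  tauto

/-- `a` is the element of `W_I` whose inversions are those of `w` inside `x W_I x⁻¹`. -/
def IsComponent (I : Set B) (x w a : W) : Prop :=
  a ∈ parab cs I ∧ ∀ r ∈ parab cs I, (r ∈ invSet cs a ↔ x * r * x⁻¹ ∈ invSet cs w)

variable {cs} in
theorem IsComponent.eq {I : Set B} {x w w' a a' : W} [Finite W] (h : IsComponent cs I x w a)
    (h' : IsComponent cs I x w' a')
    (hw : ∀ r ∈ parab cs I, (x * r * x⁻¹ ∈ invSet cs w ↔ x * r * x⁻¹ ∈ invSet cs w')) :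
    a = a' := by
  apply invSet_injective cs
  ext r
  by_cases hr : r ∈ parab cs I
  · rw [h.2 r hr, h'.2 r hr, hw r hr]
  · exact ⟨fun H => absurd (mem_parab_of_mem_invSet cs h.1 H) hr,
      fun H => absurd (mem_parab_of_mem_invSet cs h'.1 H) hr⟩

theorem isReflection_of_conj {x r : W} (h : cs.IsReflection (x * r * x⁻¹)) : cs.IsReflection r := by
  have := h.conj x⁻¹
  rwa [show x⁻¹ * (x * r * x⁻¹) * x⁻¹⁻¹ = r by group] at this

variable {cs} in
theorem IsReducedRight.isComponent {I : Set B} {x a : W} (hx : IsReducedRight cs I x)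
    (ha : a ∈ parab cs I) : IsComponent cs I x (x * a) a :=
  ⟨ha, fun _ hr => ⟨fun h => (hx.mem_invSet_mul_iff hr h.1 a).mpr h,
    fun h => (hx.mem_invSet_mul_iff hr (isReflection_of_conj cs h.1) a).mp h⟩⟩

variable {cs} in
theorem IsReducedRight.exists_isComponent [Finite W] {I : Set B} {x : W}
    (hx : IsReducedRight cs I x) (w : W) :
    ∃ a, IsComponent cs I x w a := by
  obtain ⟨a, z, hz, ha, hzr⟩ := exists_mul_left_reduced cs I (x⁻¹ * w)
  have key : ∀ r ∈ parab cs I, cs.IsReflection r →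
      (r ∈ invSet cs a ↔ x * r * x⁻¹ ∈ invSet cs w) := fun r hr ht => by
    have h1 := mem_invSet_mul_conj cs ht x (x⁻¹ * w)
    have h2 := hx r hr ht
    have h3 := hzr (a⁻¹ * r * a) (mul_mem (mul_mem (inv_mem ha) hr) ha)
    rw [mul_inv_cancel_left, hz, mem_invSet_mul cs ht] at h1
    tauto
  exact ⟨a, ha, fun r hr => ⟨fun h => (key r hr h.1).mp h,
    fun h => (key r hr (isReflection_of_conj cs h.1)).mpr h⟩⟩

/-- `x` is the minimal element of the coset `v W_I`, where `I` is the descent set of `v`. -/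
structure IsBase (v x : W) : Prop where
  isReducedRight : IsReducedRight cs (descSet cs v) x
  isLongest : IsLongest cs (descSet cs v) (x⁻¹ * v)

theorem exists_isBase [Finite W] (v : W) : ∃ x, IsBase cs v x := by
  obtain ⟨x, a, h, hx, ha⟩ := exists_eq_mul_longest cs (I := descSet cs v) (v := v) fun _ hi => hi
  exact ⟨x, hx, by rwa [h, inv_mul_cancel_left, ← h]⟩

namespace IsBase

variable {cs} {v x : W}

theorem conj_mem_descConj_iff (hb : IsBase cs v x) (r : W) :
    x * r * x⁻¹ ∈ descConj cs v ↔ r ∈ parab cs (descSet cs v) :=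
  mem_descConj_iff cs hb.isLongest.1 r

theorem mem_descConj_iff (hb : IsBase cs v x) (g : W) :
    g ∈ descConj cs v ↔ x⁻¹ * g * x ∈ parab cs (descSet cs v) := by
  rw [← hb.conj_mem_descConj_iff, show x * (x⁻¹ * g * x) * x⁻¹ = g by group]

theorem notMem_invSet (hb : IsBase cs v x) {t : W} (ht : t ∈ descConj cs v) : t ∉ invSet cs x := by
  intro h
  have := hb.isReducedRight _ ((hb.mem_descConj_iff t).mp ht) (by simpa using h.1.conj x⁻¹)
  rw [show x * (x⁻¹ * t * x) * x⁻¹ = t by group] at this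
  exact this h

theorem invSet_mul_subset (hb : IsBase cs v x) {a : W} (ha : a ∈ parab cs (descSet cs v)) :
    invSet cs (x * a) ⊆ invSet cs x ∪ descConj cs v := fun t ht =>
  ((hb.isReducedRight.mem_invSet_mul_iff_or ha ht.1).mp ht).imp_right fun h =>
    (hb.mem_descConj_iff t).mpr (mem_parab_of_mem_invSet cs ha h)

theorem invSet_mul_subset_self (hb : IsBase cs v x) {a : W} (ha : a ∈ parab cs (descSet cs v)) :
    invSet cs (x * a) ⊆ invSet cs v := fun t ht => by
  have h := hb.isReducedRight.mem_invSet_mul_iff_or hb.isLongest.1 ht.1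
  rw [mul_inv_cancel_left] at h
  exact h.mpr (((hb.isReducedRight.mem_invSet_mul_iff_or ha ht.1).mp ht).imp_right fun h =>
    hb.isLongest.2 _ (mem_parab_of_mem_invSet cs ha h) h.1)

theorem invSet_subset (hb : IsBase cs v x) : invSet cs v ⊆ invSet cs x ∪ descConj cs v := by
  have := hb.invSet_mul_subset hb.isLongest.1
  rwa [mul_inv_cancel_left] at this

theorem isRetract (hb : IsBase cs v x) {u a : W} (hu : shardLE cs u v)
    (ha : IsComponent cs (descSet cs v) x u a) :
    IsRetract cs (descConj cs v) (x * a) u := by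
  refine ⟨fun t ht => ?_, fun t ht htx => ?_, (descConj_le_iff cs).mp hu.2⟩
  · refine (hb.isReducedRight.mem_invSet_mul_iff_or ha.1 ht.1).mpr ?_
    refine (hb.invSet_subset (hu.1 ht)).imp_right fun hG => ?_
    rw [ha.2 _ ((hb.mem_descConj_iff t).mp hG)]
    rwa [show x * (x⁻¹ * t * x) * x⁻¹ = t by group]
  · have h1 := (hb.mem_descConj_iff t).mp ht
    have h := (hb.isReducedRight.isComponent ha.1).2 _ h1
    rw [ha.2 _ h1, show x * (x⁻¹ * t * x) * x⁻¹ = t by group] at h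
    exact h.mpr htx

theorem exists_shardLE (hb : IsBase cs v x) {a : W} (ha : a ∈ parab cs (descSet cs v)) :
    ∃ u, shardLE cs u v ∧ IsComponent cs (descSet cs v) x u a := by
  obtain ⟨u, hu⟩ := exists_isRetract (cs := cs) (descConj cs v) (x * a)
  refine ⟨u, ⟨hu.1.trans (hb.invSet_mul_subset_self ha), (descConj_le_iff cs).mpr hu.2.2⟩,
    ha, fun r hr => ?_⟩
  rw [(hb.isReducedRight.isComponent ha).2 r hr]
  exact ⟨hu.2.1 _ ((hb.conj_mem_descConj_iff r).mpr hr), fun h => hu.1 h⟩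

variable [Finite W]

theorem eq_of_isComponent (hb : IsBase cs v x) {u u' a : W} (hu : shardLE cs u v)
    (hu' : shardLE cs u' v)
    (ha : IsComponent cs (descSet cs v) x u a) (ha' : IsComponent cs (descSet cs v) x u' a) :
    u = u' :=
  (hb.isRetract hu ha).unique (fun _ => hb.notMem_invSet) (hb.invSet_mul_subset ha.1)
    (hb.isRetract hu' ha')

theorem conj_mem_coverRefl_iff (hb : IsBase cs v x) {u a : W} (hu : shardLE cs u v)
    (ha : IsComponent cs (descSet cs v) x u a) (r : W) :
    x * r * x⁻¹ ∈ coverRefl cs u ↔ r ∈ coverRefl cs a := by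
  constructor
  · intro h
    have hr := (hb.conj_mem_descConj_iff r).mp (hu.2 (coverRefl_subset_descConj cs u h))
    rw [mem_coverRefl_iff] at h ⊢
    have htr := isReflection_of_conj cs h.1.1
    refine ⟨(ha.2 r hr).mpr h.1, fun q hq hne => ?_⟩
    have hqJ := mem_parab_of_mem_invSet cs ha.1 hq
    have hqr : r⁻¹ * q * r ∈ parab cs (descSet cs v) := mul_mem (mul_mem (inv_mem hr) hqJ) hr
    have htq : cs.IsReflection (r⁻¹ * q * r) := by simpa using hq.1.conj r⁻¹
    have h1 := h.2 _ ((ha.2 q hqJ).mp hq) (by simpa using hne)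
    have h2 := mem_invSet_mul cs (hq.1.conj x) (x * r * x⁻¹) u
    have h3 := mem_invSet_mul_conj cs hq.1 x (r * x⁻¹)
    have h4 := hb.isReducedRight q hqJ hq.1
    have h5 := mem_invSet_mul cs hq.1 r x⁻¹
    have h6 := hb.isReducedRight _ hqr htq
    rw [← mem_invSet_inv cs htq] at h6
    have h7 := mem_invSet_mul cs hq.1 r a
    rw [ha.2 _ hqr] at h7
    rw [show (x * r * x⁻¹)⁻¹ * (x * q * x⁻¹) * (x * r * x⁻¹) = x * (r⁻¹ * q * r) * x⁻¹ by group]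
      at h2
    rw [← mul_assoc] at h3
    tauto
  · intro h
    have h' := (mem_coverRefl_iff cs).mp h
    have hr := mem_parab_of_mem_invSet cs ha.1 h'.1
    refine (hb.isRetract hu ha).mem_coverRefl (fun _ => hb.notMem_invSet)
      (hb.invSet_mul_subset ha.1) ?_ ((hb.conj_mem_descConj_iff r).mpr hr)
    refine (mem_coverRefl_iff cs).mpr
      ⟨((hb.isReducedRight.isComponent ha.1).2 r hr).mp h'.1, fun t ht hne => ?_⟩
    rw [show x * r * x⁻¹ * (x * a) = x * (r * a) by group]
    refine (hb.isReducedRight.mem_invSet_mul_iff_or (mul_mem hr ha.1) ht.1).mpr ?_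
    refine ((hb.isReducedRight.mem_invSet_mul_iff_or ha.1 ht.1).mp ht).imp_right fun hq =>
      h'.2 _ hq fun he => hne ?_
    rw [← he]; group

theorem conj_mem_descConj_iff_of_isComponent (hb : IsBase cs v x) {u a : W} (hu : shardLE cs u v)
    (ha : IsComponent cs (descSet cs v) x u a) (g : W) :
    x * g * x⁻¹ ∈ descConj cs u ↔ g ∈ descConj cs a := by
  rw [descConj_eq_map cs (hb.conj_mem_coverRefl_iff hu ha), conj_mem_map_conj]

theorem shardLE_of_shardLE (hb : IsBase cs v x) {u u' a a' : W} (hu : shardLE cs u v)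
    (hu' : shardLE cs u' v)
    (ha : IsComponent cs (descSet cs v) x u a) (ha' : IsComponent cs (descSet cs v) x u' a')
    (h : shardLE cs u u') : shardLE cs a a' := by
  refine ⟨fun r hr => ?_, fun g hg => ?_⟩
  · have hrJ := mem_parab_of_mem_invSet cs ha.1 hr
    exact (ha'.2 r hrJ).mpr (h.1 ((ha.2 r hrJ).mp hr))
  · rw [← hb.conj_mem_descConj_iff_of_isComponent hu ha] at hg
    exact (hb.conj_mem_descConj_iff_of_isComponent hu' ha' g).mp (h.2 hg)

end IsBase

variable [Finite W]

variable {cs} in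
theorem shardLE.eq_of_invSet {u u' v : W} (hu : shardLE cs u v) (hu' : shardLE cs u' v)
    (h : ∀ t ∈ descConj cs v, (t ∈ invSet cs u ↔ t ∈ invSet cs u')) : u = u' := by
  obtain ⟨x, hb⟩ := exists_isBase cs v
  obtain ⟨a, ha⟩ := hb.isReducedRight.exists_isComponent u
  obtain ⟨a', ha'⟩ := hb.isReducedRight.exists_isComponent u'
  obtain rfl := ha.eq ha' fun r hr => h _ ((hb.conj_mem_descConj_iff r).mpr hr)
  exact hb.eq_of_isComponent hu hu' ha ha'

theorem exists_shardLE_invSet (v w : W) :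
    ∃ u, shardLE cs u v ∧ ∀ t ∈ descConj cs v, (t ∈ invSet cs u ↔ t ∈ invSet cs w) := by
  obtain ⟨x, hb⟩ := exists_isBase cs v
  obtain ⟨a, ha⟩ := hb.isReducedRight.exists_isComponent w
  obtain ⟨u, hu, hua⟩ := hb.exists_shardLE ha.1
  refine ⟨u, hu, fun t ht => ?_⟩
  have hr := (hb.mem_descConj_iff t).mp ht
  have h := (hua.2 _ hr).symm.trans (ha.2 _ hr)
  rwa [show x * (x⁻¹ * t * x) * x⁻¹ = t by group] at h

theorem IsBase.shardLE_iff {v x u u' a a' : W} (hb : IsBase cs v x) (hu : shardLE cs u v)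
    (hu' : shardLE cs u' v) (ha : IsComponent cs (descSet cs v) x u a)
    (ha' : IsComponent cs (descSet cs v) x u' a') : shardLE cs u u' ↔ shardLE cs a a' := by
  refine ⟨hb.shardLE_of_shardLE hu hu' ha ha', fun h => ?_⟩
  obtain ⟨u₁, hu₁, hinv⟩ := exists_shardLE_invSet cs u' u
  obtain ⟨a₁, ha₁⟩ := hb.isReducedRight.exists_isComponent u₁
  have hu₁v := shardLE.trans cs hu₁ hu'
  obtain rfl : a₁ = a :=
    (hb.shardLE_of_shardLE hu₁v hu' ha₁ ha' hu₁).eq_of_invSet h fun t ht => by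
      have ht' := (hb.conj_mem_descConj_iff_of_isComponent hu' ha' t).mpr ht
      have htJ := (hb.conj_mem_descConj_iff t).mp (hu'.2 ht')
      rw [ha₁.2 t htJ, ha.2 t htJ, hinv _ ht']
  exact hb.eq_of_isComponent hu₁v hu ha₁ ha ▸ hu₁

/-- The lower interval of `v` in the shard order is isomorphic to the shard order on the parabolic
subgroup generated by the descents of `v`. -/
theorem exists_shardInterval_equiv (v : W) :
    ∃ φ : {u // shardLE cs u v} ≃ parab cs (descSet cs v),
      ∀ u u', shardLE cs u.1 u'.1 ↔ shardLE cs (φ u : W) (φ u') := by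
  obtain ⟨x, hb⟩ := exists_isBase cs v
  choose φ hφ using fun u => hb.isReducedRight.exists_isComponent u
  let f : {u // shardLE cs u v} → parab cs (descSet cs v) := fun u => ⟨φ u.1, (hφ u.1).1⟩
  have hf : Function.Bijective f := by
    refine ⟨fun u u' h => Subtype.ext ?_, fun a => ?_⟩
    · have h' : φ u.1 = φ u'.1 := congrArg Subtype.val h
      exact hb.eq_of_isComponent u.2 u'.2 (hφ u.1) (h' ▸ hφ u'.1)
    · obtain ⟨u, hu, hua⟩ := hb.exists_shardLE a.2
      exact ⟨⟨u, hu⟩, Subtype.ext ((hφ u).eq hua fun _ _ => Iff.rfl)⟩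
  exact ⟨Equiv.ofBijective f hf, fun u u' =>
    hb.shardLE_iff cs u.2 u'.2 (hφ u.1) (hφ u'.1)⟩

theorem shardLE.mem_parab {u v : W} {I : Set B} (h : shardLE cs u v) (hv : v ∈ parab cs I) :
    u ∈ parab cs I := by
  have hlen := length_eq_of_invSet_subset cs h.1
  have hsub : parab cs (supp cs u) ≤ parab cs I := (parab_le_iff cs).mpr fun i hi =>
    simple_mem_parab_of_mem_supp cs hv (by
      have := supp_union_subset cs (x := u) (u := u⁻¹ * v) (by simpa using hlen)
      rw [mul_inv_cancel_left] at this
      exact this (Or.inl hi))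
  exact hsub (mem_parab_supp cs u)

end ShardInterval

section ChainCount

variable {α : Type*}

/-- The number of `k`-chains for the relation `r` with all elements satisfying `p`. -/
noncomputable def chainCount (r : α → α → Prop) (p : α → Prop) (k : ℕ) : ℕ :=
  Nat.card {c : Fin k → α // (∀ i j, i ≤ j → r (c i) (c j)) ∧ ∀ i, p (c i)}

theorem chainCount_zero (r : α → α → Prop) (p : α → Prop) : chainCount r p 0 = 1 := by
  rw [chainCount, Nat.card_eq_one_iff_unique]
  exact ⟨⟨fun a b => Subtype.ext (Subsingleton.elim _ _)⟩,
    ⟨⟨Fin.elim0, fun i => i.elim0, fun i => i.elim0⟩⟩⟩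

theorem chainCount_succ [Fintype α] {r : α → α → Prop} (hr : ∀ a, r a a)
    {p : α → Prop} (hp : ∀ a b, p a → r a b → p b) (k : ℕ) :
    chainCount r p (k + 1) = ∑ v, if p v then chainCount r (r v) k else 0 := by
  have e : {c : Fin (k + 1) → α // (∀ i j, i ≤ j → r (c i) (c j)) ∧ ∀ i, p (c i)} ≃
      Σ v : {v // p v}, {c : Fin k → α // (∀ i j, i ≤ j → r (c i) (c j)) ∧ ∀ i, r v.1 (c i)} :=
    { toFun := fun c => ⟨⟨c.1 0, c.2.2 0⟩, ⟨fun i => c.1 i.succ,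
        fun i j h => c.2.1 _ _ (Fin.succ_le_succ_iff.mpr h), fun i => c.2.1 _ _ (Fin.zero_le _)⟩⟩
      invFun := fun c => ⟨Fin.cons c.1.1 c.2.1, by
        constructor
        · intro i j
          refine Fin.cases (Fin.cases ?_ (fun j => ?_) j) (fun i => Fin.cases ?_ (fun j => ?_) j) i
          · exact fun _ => hr _
          · exact fun _ => c.2.2.2 j
          · exact fun h => absurd h (by simp)
          · exact fun h => c.2.2.1 i j (Fin.succ_le_succ_iff.mp h)
        · exact fun i => Fin.cases c.1.2 (fun i => hp _ _ c.1.2 (c.2.2.2 i)) i⟩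
      left_inv := fun c => Subtype.ext (Fin.cons_self_tail c.1)
      right_inv := fun c => rfl }
  rw [chainCount, Nat.card_congr e, Nat.card_sigma, ← Finset.sum_filter]
  exact (Finset.sum_subtype _ (by simp) fun v => chainCount r (r v) k).symm

theorem chainCount_congr {r : α → α → Prop} {p q : α → Prop} (φ : {u // p u} ≃ {u // q u})
    (hφ : ∀ u v, r u.1 v.1 ↔ r (φ u).1 (φ v).1) (k : ℕ) :
    chainCount r p k = chainCount r q k := by
  refine Nat.card_congr
    { toFun := fun c => ⟨fun i => (φ ⟨c.1 i, c.2.2 i⟩).1,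
        fun i j h => (hφ _ _).mp (c.2.1 i j h), fun i => (φ _).2⟩
      invFun := fun c => ⟨fun i => (φ.symm ⟨c.1 i, c.2.2 i⟩).1,
        fun i j h => (hφ _ _).mpr (by simpa using c.2.1 i j h), fun i => (φ.symm _).2⟩
      left_inv := fun c => by simp
      right_inv := fun c => by simp }

theorem chainCount_flip (r : α → α → Prop) (p : α → Prop) (k : ℕ) :
    chainCount (fun a b => r b a) p k = chainCount r p k :=
  Nat.card_congr
    { toFun := fun c => ⟨fun i => c.1 i.rev, fun i j h => c.2.1 _ _ (Fin.rev_le_rev.mpr h),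
        fun i => c.2.2 _⟩
      invFun := fun c => ⟨fun i => c.1 i.rev, fun i j h => c.2.1 _ _ (Fin.rev_le_rev.mpr h),
        fun i => c.2.2 _⟩
      left_inv := fun c => by simp
      right_inv := fun c => by simp }

theorem card_chains_eq_chainCount (r : α → α → Prop) {p : α → Prop} (hp : ∀ a, p a) (k : ℕ) :
    Nat.card {c : Fin k → α // ∀ i j : Fin k, i ≤ j → r (c i) (c j)} = chainCount r p k :=
  Nat.card_congr (Equiv.subtypeEquivRight fun c => by simp [hp])

end ChainCount

section Recursion

theorem parab_supp_le_iff {I : Set B} {w : W} :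
    parab cs (supp cs w) ≤ parab cs I ↔ w ∈ parab cs I :=
  ⟨fun h => h (mem_parab_supp cs w), fun h => (parab_le_iff cs).mpr fun _ hi =>
    simple_mem_parab_of_mem_supp cs h hi⟩

theorem parab_union_le_iff {I J K : Set B} :
    parab cs (I ∪ J) ≤ parab cs K ↔ parab cs I ≤ parab cs K ∧ parab cs J ≤ parab cs K := by
  simp only [parab_le_iff, Set.mem_union, or_imp, forall_and]

theorem parab_descSet_le {J : Set B} {v : W} (hv : v ∈ parab cs J) :
    parab cs (descSet cs v) ≤ parab cs J := (parab_le_iff cs).mpr fun i hi => by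
  have := mem_parab_of_mem_invSet cs hv ((conj_simple_mem_invSet_iff cs v i).mpr hi)
  rwa [mul_mem_cancel_right (inv_mem hv), mul_mem_cancel_left hv] at this

theorem parab_le_descSet_iff {I : Set B} {v : W} :
    parab cs I ≤ parab cs (descSet cs v) ↔ ∀ i ∈ I, cs.IsRightDescent v i := by
  refine ⟨fun h i hi => ?_, fun h => parab_mono cs h⟩
  obtain ⟨j, hj, hij⟩ := exists_simple_eq_of_mem_parab cs (h (simple_mem_parab cs hi))
  rw [CoxeterSystem.IsRightDescent, hij]
  exact hj

variable [Fintype W]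

/-- A two-parameter refinement of the number of `k`-chains in the BHZ order. -/
noncomputable def bhzCount : ℕ → Set B → Set B → ℕ
  | 0, I, J => if parab cs I ≤ parab cs J then 1 else 0
  | k + 1, I, J => ∑ x : W, if IsMinRep cs I x then bhzCount k (I ∪ supp cs x) J else 0

/-- A two-parameter refinement of the number of `k`-chains in the shard order. -/
noncomputable def shardCount : ℕ → Set B → Set B → ℕ
  | 0, I, J => if parab cs I ≤ parab cs J then 1 else 0
  | k + 1, I, J => ∑ v : W, if v ∈ parab cs J then shardCount k I (descSet cs v) else 0

theorem isMinRep_and_parab_le_iff {I J : Set B} {a : W} (ha : IsLongest cs I a) (x : W) :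
    IsMinRep cs I x ∧ parab cs (I ∪ supp cs x) ≤ parab cs J ↔
      x * a ∈ parab cs J ∧ parab cs I ≤ parab cs (descSet cs (x * a)) := by
  rw [parab_union_le_iff, parab_supp_le_iff, isMinRep_iff, parab_le_descSet_iff]
  constructor
  · rintro ⟨hx, hIJ, hxJ⟩
    exact ⟨mul_mem hxJ (hIJ ha.1), fun i hi =>
      (hx.isRightDescent_mul_iff ha.1 hi).mpr (ha.isRightDescent hi)⟩
  · rintro ⟨hJ, hd⟩
    obtain ⟨y, b, hyb, hy, hb⟩ := exists_eq_mul_longest cs hd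
    obtain rfl := ha.eq hb
    obtain rfl := mul_right_cancel hyb
    have hIJ := ((parab_le_descSet_iff cs).mpr hd).trans (parab_descSet_le cs hJ)
    exact ⟨hy, hIJ, (mul_mem_cancel_right (hIJ ha.1)).mp hJ⟩

theorem bhzCount_succ (k : ℕ) (I J : Set B) :
    bhzCount cs (k + 1) I J =
      ∑ v : W, if v ∈ parab cs J then bhzCount cs k I (descSet cs v) else 0 := by
  induction k generalizing I J with
  | zero =>
    obtain ⟨a, ha⟩ := exists_isLongest cs I
    rw [← Equiv.sum_comp (Equiv.mulRight a), bhzCount]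
    refine Finset.sum_congr rfl fun x _ => ?_
    simp only [bhzCount, Equiv.coe_mulRight]
    exact (ite_and ..).symm.trans
      ((if_congr (isMinRep_and_parab_le_iff cs ha x) rfl rfl).trans (ite_and ..))
  | succ k ih =>
    conv_lhs =>
      rw [bhzCount]
      simp only [ih, ← Finset.sum_filter]
    rw [Finset.sum_comm]
    simp only [bhzCount, Finset.sum_filter]

theorem bhzCount_eq_shardCount (k : ℕ) (I J : Set B) :
    bhzCount cs k I J = shardCount cs k I J := by
  induction k generalizing I J with
  | zero => rfl
  | succ k ih => simp only [bhzCount_succ, shardCount, ih]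

end Recursion

section BHZ

theorem mem_supp_of_simple_eq {w : W} {i j : B} (hi : i ∈ supp cs w)
    (h : cs.simple i = cs.simple j) : j ∈ supp cs w := by
  obtain ⟨l, hl, rfl, hil⟩ := hi
  have hw : cs.wordProd (l.map fun k => if k = i then j else k) = cs.wordProd l := by
    rw [CoxeterSystem.wordProd, CoxeterSystem.wordProd, List.map_map]
    congr 1
    refine List.map_congr_left fun k _ => ?_
    by_cases hk : k = i <;> simp [hk, h]
  refine ⟨_, ?_, hw, List.mem_map.mpr ⟨i, hil, if_pos rfl⟩⟩
  rw [CoxeterSystem.IsReduced, hw, hl, List.length_map]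

theorem supp_mul {x u : W} (h : cs.length (x * u) = cs.length x + cs.length u) :
    supp cs (x * u) = supp cs u ∪ supp cs x := by
  refine subset_antisymm (fun i hi => ?_) (Set.union_comm _ _ ▸ supp_union_subset cs h)
  have hm : x * u ∈ parab cs (supp cs u ∪ supp cs x) :=
    mul_mem (parab_mono cs Set.subset_union_right (mem_parab_supp cs x))
      (parab_mono cs Set.subset_union_left (mem_parab_supp cs u))
  obtain ⟨j, hj, hij⟩ := exists_simple_eq_of_mem_parab cs (simple_mem_parab_of_mem_supp cs hm hi)
  exact hj.imp (fun hj => mem_supp_of_simple_eq cs hj hij.symm)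
    fun hj => mem_supp_of_simple_eq cs hj hij.symm

theorem supp_one : supp cs 1 = ∅ := by
  refine Set.eq_empty_of_forall_notMem fun i ⟨l, hl, h1, hi⟩ => ?_
  rw [CoxeterSystem.IsReduced, h1, cs.length_one, eq_comm, List.length_eq_zero_iff] at hl
  simp [hl] at hi

theorem parab_univ : parab cs Set.univ = ⊤ := by
  rw [parab, Set.image_univ, cs.subgroup_closure_range_simple]

section

variable [Finite W]

theorem bhzLE_mul_iff {x u : W} : bhzLE cs u (x * u) ↔ IsMinRep cs (supp cs u) x := by
  rw [bhzLE, mul_inv_cancel_right]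
  exact ⟨fun h => h.2.1, fun h => ⟨mem_parab_supp cs u, h,
    ((isMinRep_iff cs).mp h).length_mul (mem_parab_supp cs u)⟩⟩

theorem bhzLE_refl (u : W) : bhzLE cs u u := by
  have : IsMinRep cs (supp cs u) 1 := fun i _ h => by simp [CoxeterSystem.IsRightDescent] at h
  simpa using (bhzLE_mul_iff cs).mpr this

theorem one_bhzLE (u : W) : bhzLE cs 1 u := by
  have : IsMinRep cs (supp cs 1) u := fun i hi => by simp [supp_one] at hi
  simpa using (bhzLE_mul_iff cs).mpr this

theorem supp_mul_of_isMinRep {x u : W} (hx : IsMinRep cs (supp cs u) x) :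
    supp cs (x * u) = supp cs u ∪ supp cs x :=
  supp_mul cs (((isMinRep_iff cs).mp hx).length_mul (mem_parab_supp cs u))

theorem bhzLE_trans {u v w : W} (h : bhzLE cs u v) (h' : bhzLE cs v w) : bhzLE cs u w := by
  obtain ⟨x, rfl⟩ : ∃ x, v = x * u := ⟨v * u⁻¹, by simp⟩
  obtain ⟨y, rfl⟩ : ∃ y, w = y * (x * u) := ⟨w * (x * u)⁻¹, (inv_mul_cancel_right w _).symm⟩
  rw [bhzLE_mul_iff] at h h'
  rw [← mul_assoc, bhzLE_mul_iff]
  rw [supp_mul_of_isMinRep cs h, isMinRep_iff] at h'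
  intro i hi
  rw [h'.isRightDescent_mul_iff (parab_mono cs Set.subset_union_right (mem_parab_supp cs x))
    (Or.inl hi)]
  exact h i hi

end

theorem chainCount_bhzLE [Fintype W] (k : ℕ) (u : W) :
    chainCount (bhzLE cs) (bhzLE cs u) k = bhzCount cs k (supp cs u) Set.univ := by
  induction k generalizing u with
  | zero => simp [chainCount_zero, bhzCount, parab_univ]
  | succ k ih =>
    rw [chainCount_succ (bhzLE_refl cs) fun _ _ => bhzLE_trans cs,
      ← Equiv.sum_comp (Equiv.mulRight u), bhzCount]
    refine Finset.sum_congr rfl fun x _ => ?_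
    simp only [Equiv.coe_mulRight, bhzLE_mul_iff, ih]
    split_ifs with hx
    · rw [supp_mul_of_isMinRep cs hx]
    · rfl

theorem chainCount_shardLE [Fintype W] (k : ℕ) (J : Set B) :
    chainCount (shardLE cs) (fun w => w ∈ parab cs J) k = shardCount cs k ∅ J := by
  induction k generalizing J with
  | zero =>
    have : parab cs ∅ = ⊥ := by simp [parab]
    simp [chainCount_zero, shardCount, this]
  | succ k ih =>
    rw [← chainCount_flip, chainCount_succ (fun _ => ⟨subset_rfl, le_rfl⟩)
      (fun _ _ hv h => shardLE.mem_parab cs h hv), shardCount]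
    refine Finset.sum_congr rfl fun v _ => ?_
    obtain ⟨φ, hφ⟩ := exists_shardInterval_equiv cs v
    rw [← ih, chainCount_flip, chainCount_congr φ hφ]

end BHZ

/-- For every `k ≥ 1`, the number of `k`-chains in the shard order equals the number of
`k`-chains in the BHZ order. -/
theorem chains_card_eq [Finite W] (k : ℕ) (hk : 1 ≤ k) :
    Nat.card {c : Fin k → W // ∀ i j : Fin k, i ≤ j → shardLE cs (c i) (c j)} =
      Nat.card {c : Fin k → W // ∀ i j : Fin k, i ≤ j → bhzLE cs (c i) (c j)} := by
  cases nonempty_fintype W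
  rw [card_chains_eq_chainCount _ (p := fun w => w ∈ parab cs Set.univ) (by simp [parab_univ]),
    card_chains_eq_chainCount _ (one_bhzLE cs), chainCount_shardLE, chainCount_bhzLE, supp_one,
    bhzCount_eq_shardCount]

end ShardBHZ
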